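/- arXiv:2308.01782 — 2 statements merged into one kernel-verified Lean document; each statement's English description precedes it below -/
import Mathlib

section
/- Let n ≥ 1, R > 0, k ≥ 1 an integer, 1 < p < ∞, b > 1, a + (k-1)p < n and 0 < c ≤ (n-a-(k-1)p)/(b+(k-1)p-1). For a real-valued f ∈ C_0^k(B(0,R)\{0}) set, for each 1 ≤ i ≤ k, u_i(x) = (p/((b+(i-1)p-1)c)) · |x| (1-(|x|/R)^c) · (−𝓡^{k-i+1}f(x)). Then the following identity holds: ∏_{j=0}^{k-1} ((b+jp-1)c/p)^p · ∫_{B(0,R)} |f(x)|^p / (|x|^{a+(k-1)p} (1-(|x|/R)^c)^{b+(k-1)p}) dx + p · Σ_{i=1}^{k} [∏_{j=0}^{i-1} ((b+jp-1)c/p)^p] · ∫_{B(0,R)} I_p(𝓡^{k-i}f, u_i)(x) · |𝓡^{k-i}f(x) - u_i(x)|² / (|x|^{a+(i-1)p} (1-(|x|/R)^c)^{b+(i-1)p}) dx + Σ_{i=1}^{k} (n-a-(i-1)p-(b+(i-1)p-1)c) · ((b+(i-1)p-1)c/p)^{-1} · [∏_{j=0}^{i-1} ((b+jp-1)c/p)^p]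 · ∫_{B(0,R)} |𝓡^{k-i}f(x)|^p / (|x|^{a+(i-1)p} (1-(|x|/R)^c)^{b+(i-1)p-1}) dx = ∫_{B(0,R)} |𝓡^k f(x)|^p / (|x|^{a-p} (1-(|x|/R)^c)^{b-p}) dx. -/
open MeasureTheory Metric

/-- The radial derivative `𝓡f(x) = Df(x)[x/|x|]` of a real-valued function on `ℝⁿ`. -/
noncomputable def radDerivR {n : ℕ} (f : EuclideanSpace ℝ (Fin n) → ℝ)
    (x : EuclideanSpace ℝ (Fin n)) : ℝ :=
  fderiv ℝ f x (‖x‖⁻¹ • x)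

/-- `I_p(v, u) = (p-1) ∫₀¹ |ξ v + (1-ξ) u|^{p-2} ξ dξ`. -/
noncomputable def Ip (p v u : ℝ) : ℝ :=
  (p - 1) * ∫ ξ in (0:ℝ)..1, |ξ * v + (1 - ξ) * u| ^ (p - 2) * ξ

/-- A function is `C^m` as soon as it is `C^m` at every point of its topological support. -/
lemma contDiff_of_contDiffAt_tsupport {E F : Type*} [NormedAddCommGroup E] [NormedSpace ℝ E]
    [NormedAddCommGroup F] [NormedSpace ℝ F] {m : WithTop ℕ∞} {g : E → F}
    (h : ∀ x ∈ tsupport g, ContDiffAt ℝ m g x) : ContDiff ℝ m g := by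
  rw [contDiff_iff_contDiffAt]
  intro x
  by_cases hx : x ∈ tsupport g
  · exact h x hx
  · exact contDiffAt_const.congr_of_eventuallyEq (notMem_tsupport_iff_eventuallyEq.1 hx)

lemma integrable_of_continuousOn_of_eq_zero {E : Type*} [TopologicalSpace E] [T2Space E]
    [MeasurableSpace E] [BorelSpace E] {μ : Measure E} [IsFiniteMeasureOnCompacts μ]
    {K : Set E} (hK : IsCompact K) {g : E → ℝ} (hg : ContinuousOn g K)
    (h0 : ∀ x ∉ K, g x = 0) : Integrable g μ := by
  rw [← integrableOn_iff_integrable_of_support_subset (s := K)]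
  · exact hg.integrableOn_compact' hK hK.measurableSet
  · intro x hx
    by_contra h
    exact hx (h0 x h)

lemma radDerivR_of_notMem_tsupport {n : ℕ} {v : EuclideanSpace ℝ (Fin n) → ℝ}
    {x : EuclideanSpace ℝ (Fin n)} (hx : x ∉ tsupport v) : radDerivR v x = 0 := by
  simp [radDerivR, fderiv_of_notMem_tsupport (𝕜 := ℝ) hx]

lemma tsupport_radDerivR_subset {n : ℕ} (v : EuclideanSpace ℝ (Fin n) → ℝ) :
    tsupport (radDerivR v) ⊆ tsupport v := by
  refine closure_minimal (fun x hx => ?_) isClosed_closure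
  by_contra h
  exact hx (radDerivR_of_notMem_tsupport h)

lemma ContDiff.radDerivR {n : ℕ} {m : ℕ} {v : EuclideanSpace ℝ (Fin n) → ℝ}
    (hv : ContDiff ℝ (m + 1 : ℕ) v) (h0 : (0 : EuclideanSpace ℝ (Fin n)) ∉ tsupport v) :
    ContDiff ℝ m (radDerivR v) := by
  refine contDiff_of_contDiffAt_tsupport fun x hx => ?_
  have hx0 : x ≠ 0 := by
    rintro rfl
    exact h0 (tsupport_radDerivR_subset v hx)
  have h1 : ContDiff ℝ m (fderiv ℝ v) := hv.fderiv_right (by norm_cast)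
  exact h1.contDiffAt.clm_apply
    (((contDiffAt_norm ℝ hx0).inv (norm_ne_zero_iff.2 hx0)).smul contDiffAt_id)

lemma radDerivR_iterate_regularity {n : ℕ} {f : EuclideanSpace ℝ (Fin n) → ℝ}
    (h0 : (0 : EuclideanSpace ℝ (Fin n)) ∉ tsupport f) (m l : ℕ) (hf : ContDiff ℝ (l + m : ℕ) f) :
    ContDiff ℝ l (radDerivR^[m] f) ∧ tsupport (radDerivR^[m] f) ⊆ tsupport f := by
  induction m generalizing l with
  | zero => exact ⟨hf, subset_rfl⟩
  | succ m ih =>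
    obtain ⟨h1, h2⟩ := ih (l + 1) (by convert hf using 2; ring)
    rw [Function.iterate_succ_apply']
    exact ⟨ContDiff.radDerivR h1 fun h => h0 (h2 h), (tsupport_radDerivR_subset _).trans h2⟩

/-- Integrating the divergence of the compactly supported field `x ↦ G x • x`. -/
lemma integral_fderiv_apply_self {n : ℕ} {G : EuclideanSpace ℝ (Fin n) → ℝ}
    (hG : ContDiff ℝ 1 G) (hc : HasCompactSupport G) :
    ∫ x, fderiv ℝ G x x = -(n * ∫ x, G x) := by
  have hcont : Continuous (fderiv ℝ G) := hG.continuous_fderiv one_ne_zero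
  have hint (i : Fin n) : Integrable fun x : EuclideanSpace ℝ (Fin n) =>
      x i * fderiv ℝ G x (EuclideanSpace.single i 1) := by
    refine integrable_of_continuousOn_of_eq_zero (K := tsupport G) hc
      (by fun_prop) fun x hx => ?_
    simp [fderiv_of_notMem_tsupport (𝕜 := ℝ) hx]
  have hGi : Integrable G := hG.continuous.integrable_of_hasCompactSupport hc
  have hproj (i : Fin n) (x : EuclideanSpace ℝ (Fin n)) :
      fderiv ℝ (fun y : EuclideanSpace ℝ (Fin n) => y i) x (EuclideanSpace.single i 1) = 1 := by
    have : HasFDerivAt (fun y : EuclideanSpace ℝ (Fin n) => y i)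
      (EuclideanSpace.proj (𝕜 := ℝ) i) x := (EuclideanSpace.proj (𝕜 := ℝ) i).hasFDerivAt
    simp [this.fderiv]
  have key (i : Fin n) :
      ∫ x : EuclideanSpace ℝ (Fin n), x i * fderiv ℝ G x (EuclideanSpace.single i 1)
        = -∫ x, G x := by
    rw [integral_mul_fderiv_eq_neg_fderiv_mul_of_integrable
      (f := fun x : EuclideanSpace ℝ (Fin n) => x i) (g := G)]
    · simp [hproj]
    · simpa [hproj] using hGi
    · exact hint i
    · refine Continuous.integrable_of_hasCompactSupport ?_ hc.mul_left
      exact (by fun_prop : Continuous fun x : EuclideanSpace ℝ (Fin n) => x i).mul hG.continuous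
    · intro x _
      fun_prop
    · exact fun x _ => hG.differentiable one_ne_zero x
  have hsum (x : EuclideanSpace ℝ (Fin n)) :
      fderiv ℝ G x x = ∑ i, x i * fderiv ℝ G x (EuclideanSpace.single i 1) := by
    conv_lhs => arg 2; rw [← (EuclideanSpace.basisFun (Fin n) ℝ).sum_repr x]
    rw [map_sum]
    simp
  simp_rw [hsum]
  rw [integral_finsetSum _ fun i _ => hint i]
  simp [key]

lemma intervalIntegrable_abs_rpow {r : ℝ} (hr : -1 < r) (s t : ℝ) :
    IntervalIntegrable (fun y : ℝ => |y| ^ r) volume s t := by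
  refine intervalIntegrable_of_even (fun x => by rw [abs_neg]) fun x hx => ?_
  refine (intervalIntegral.intervalIntegrable_rpow' hr).congr ?_
  intro y hy
  rw [Set.uIoc_of_le hx.le] at hy
  simp [abs_of_pos hy.1]

lemma continuous_abs_rpow_mul_self {p : ℝ} (hp : 1 < p) :
    Continuous fun y : ℝ => |y| ^ (p - 2) * y := by
  have h := (contDiff_norm_rpow (E := ℝ) hp).continuous_deriv le_rfl
  have h2 : (fun y : ℝ => |y| ^ (p - 2) * y) = fun y => p⁻¹ * deriv (fun x : ℝ => ‖x‖ ^ p) y := by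
    funext y
    rw [(hasDerivAt_norm_rpow y hp).deriv, Real.norm_eq_abs]
    field_simp
  rw [h2]
  exact continuous_const.mul h

lemma hasDerivAt_abs_rpow_mul_self {y : ℝ} (p : ℝ) (hy : y ≠ 0) :
    HasDerivAt (fun y : ℝ => |y| ^ (p - 2) * y) ((p - 1) * |y| ^ (p - 2)) y := by
  have h : HasDerivAt (fun y : ℝ => |y| ^ (p - 2)) _ y :=
    (hasDerivAt_abs hy).rpow_const (p := p - 2) (Or.inl (abs_ne_zero.2 hy))
  refine (h.mul (hasDerivAt_id y)).congr_deriv ?_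
  rw [Real.rpow_sub_one (abs_ne_zero.2 hy), id]
  have : (SignType.sign y : ℝ) * y = |y| := sign_mul_self y
  have h3 : |y| ≠ 0 := abs_ne_zero.2 hy
  calc _ = (p - 2) * (|y| ^ (p - 2) / |y|) * ((SignType.sign y : ℝ) * y) + |y| ^ (p - 2) := by ring
    _ = _ := by rw [this]; field_simp; ring

/-- Taylor expansion of `|·|^p` at `v` with integral remainder expressed through `Ip`. -/
lemma abs_rpow_eq_add_Ip {p : ℝ} (hp : 1 < p) (v u : ℝ) :
    |u| ^ p = |v| ^ p + p * |v| ^ (p - 2) * v * (u - v) + p * (Ip p v u * |v - u| ^ 2) := by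
  rcases eq_or_ne v u with rfl | huv
  · simp
  have hd : v - u ≠ 0 := sub_ne_zero.2 huv
  set l : ℝ → ℝ := fun ξ => ξ * v + (1 - ξ) * u with hl
  have hl' (ξ : ℝ) : HasDerivAt l (v - u) ξ := by
    have := ((hasDerivAt_id ξ).mul_const v).add (((hasDerivAt_id ξ).const_sub 1).mul_const u)
    exact this.congr_deriv (by ring)
  have hlc : Continuous l := by fun_prop
  have hF : ∫ ξ in (0:ℝ)..1, (p - 1) * (|l ξ| ^ (p - 2) * ξ) =
      (1 * (|l 1| ^ (p - 2) * l 1) / (v - u) - |l 1| ^ p / (p * (v - u) ^ 2)) -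
      (0 * (|l 0| ^ (p - 2) * l 0) / (v - u) - |l 0| ^ p / (p * (v - u) ^ 2)) := by
    refine integral_eq_of_hasDerivAt_off_countable
      (fun ξ => ξ * (|l ξ| ^ (p - 2) * l ξ) / (v - u) - |l ξ| ^ p / (p * (v - u) ^ 2))
      _ (s := {u / (u - v)}) (Set.countable_singleton _) ?_ ?_ ?_
    · have h1 : Continuous fun ξ => |l ξ| ^ (p - 2) * l ξ :=
        (continuous_abs_rpow_mul_self hp).comp hlc
      have h2 : Continuous fun ξ => |l ξ| ^ p :=
        hlc.abs.rpow_const fun _ => Or.inr (by linarith)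
      exact (((continuous_id.mul h1).div_const _).sub (h2.div_const _)).continuousOn
    · rintro ξ ⟨-, hξ⟩
      have hlξ : l ξ ≠ 0 := by
        intro h
        apply hξ
        have : u - v ≠ 0 := sub_ne_zero.2 huv.symm
        rw [Set.mem_singleton_iff, eq_div_iff this]
        simp only [hl] at h
        linarith
      have h1 := (hasDerivAt_abs_rpow_mul_self p hlξ).comp ξ (hl' ξ)
      have h2 := (hasDerivAt_abs_rpow (l ξ) hp).comp ξ (hl' ξ)
      refine ((((hasDerivAt_id ξ).mul h1).div_const (v - u)).sub
        (h2.div_const (p * (v - u) ^ 2))).congr_deriv ?_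
      have : p ≠ 0 := by linarith
      simp only [Function.comp, id]
      field_simp
      ring
    · have h1 : IntervalIntegrable (fun ξ => |l ξ| ^ (p - 2)) volume 0 1 := by
        have h := ((intervalIntegrable_abs_rpow (by linarith : -1 < p - 2) u v).comp_add_left u
          (by finiteness)).comp_mul_left (c := v - u) (by finiteness) (by finiteness)
        rw [sub_self, zero_div, div_self hd] at h
        convert h using 3 with ξ
        simp only [hl]
        ring_nf
      exact (h1.mul_continuousOn continuousOn_id).const_mul _
  have hIp : Ip p v u = |v| ^ (p - 2) * v / (v - u) - |v| ^ p / (p * (v - u) ^ 2)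
      + |u| ^ p / (p * (v - u) ^ 2) := by
    rw [Ip, ← intervalIntegral.integral_const_mul]
    simp only [hl] at hF
    rw [hF]
    simp
  have hp0 : p ≠ 0 := by linarith
  rw [hIp, sq_abs]
  field_simp
  ring

lemma one_sub_div_rpow_pos {s R c : ℝ} (hc : 0 < c) (hs : 0 < s) (hsR : s < R) :
    0 < 1 - (s / R) ^ c := by
  have hR : 0 < R := hs.trans hsR
  have : (s / R) ^ c < 1 := Real.rpow_lt_one (by positivity) ((div_lt_one hR).2 hsR) hc
  linarith

lemma hasDerivAt_hardyWeight {r R c : ℝ} (hc : 0 < c) (hr : 0 < r) (hrR : r < R) (α β : ℝ) :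
    HasDerivAt (fun t : ℝ => (t * r) ^ (-α) * (1 - (t * r / R) ^ c) ^ (1 - β))
      ((-α) * r ^ (-α) * (1 - (r / R) ^ c) ^ (1 - β)
        + (β - 1) * c * (r / R) ^ c * r ^ (-α) * (1 - (r / R) ^ c) ^ (-β)) 1 := by
  have hR : 0 < R := hr.trans hrR
  have hφ := one_sub_div_rpow_pos hc hr hrR
  have h0 : HasDerivAt (fun t : ℝ => t * r) r 1 := by
    simpa using (hasDerivAt_id (1 : ℝ)).mul_const r
  have h1 := h0.rpow_const (p := -α) (Or.inl (by simpa using hr.ne'))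
  have h2 := (h0.div_const R).rpow_const (p := c) (Or.inl (by rw [one_mul]; positivity))
  have h3 := (h2.const_sub 1).rpow_const (p := 1 - β)
    (Or.inl (by rw [one_mul]; exact hφ.ne'))
  refine (h1.mul h3).congr_deriv ?_
  simp only [one_mul]
  rw [Real.rpow_sub_one hr.ne', Real.rpow_sub_one (by positivity : r / R ≠ 0),
    show 1 - β - 1 = -β by ring]
  field_simp
  ring

lemma contDiffAt_hardyWeight {n : ℕ} {R c : ℝ} (hc : 0 < c) {x : EuclideanSpace ℝ (Fin n)}
    (hx : x ∈ ball (0 : EuclideanSpace ℝ (Fin n)) R \ {0}) (s t : ℝ) :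
    ContDiffAt ℝ 1 (fun x : EuclideanSpace ℝ (Fin n) => ‖x‖ ^ s * (1 - (‖x‖ / R) ^ c) ^ t) x := by
  have hx0 : x ≠ 0 := hx.2
  have hr : 0 < ‖x‖ := norm_pos_iff.2 hx0
  have hrR : ‖x‖ < R := mem_ball_zero_iff.1 hx.1
  have hR : 0 < R := hr.trans hrR
  have hn : ContDiffAt ℝ 1 (fun x : EuclideanSpace ℝ (Fin n) => ‖x‖) x := contDiffAt_norm ℝ hx0
  exact (hn.rpow_const_of_ne hr.ne').mul ((contDiffAt_const.sub
    ((hn.div_const R).rpow_const_of_ne (by positivity))).rpow_const_of_ne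
      (one_sub_div_rpow_pos hc hr hrR).ne')

/-- The pointwise form of the first-order `L^p` Hardy identity: `E` stands for the radial
derivative, `φ` for `1 - (r / R) ^ c`. -/
lemma hardy_pointwise {p A r φ V E α β N c : ℝ} (hp : 1 < p) (hA : 0 < A) (hr : 0 < r)
    (hφ : 0 < φ) (hAc : p * A = (β - 1) * c) {u : ℝ} (hu : u = A⁻¹ * r * φ * -E) :
    A ^ p * (|V| ^ p / (r ^ α * φ ^ β)) + p * A ^ p * (Ip p V u * |V - u| ^ 2 / (r ^ α * φ ^ β))
      + (N - α - (β - 1) * c) * A⁻¹ * A ^ p * (|V| ^ p / (r ^ α * φ ^ (β - 1)))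
      - |E| ^ p / (r ^ (α - p) * φ ^ (β - p))
    = A ^ p * A⁻¹ * (N * (|V| ^ p * (r ^ (-α) * φ ^ (1 - β)))
      + (p * |V| ^ (p - 2) * V * (r * E) * (r ^ (-α) * φ ^ (1 - β)) +
        |V| ^ p * ((-α) * r ^ (-α) * φ ^ (1 - β)
        + (β - 1) * c * (1 - φ) * r ^ (-α) * φ ^ (-β)))) := by
  have hT := abs_rpow_eq_add_Ip hp V u
  have hVV : |V| ^ (p - 2) * V * V = |V| ^ p := by
    rcases eq_or_ne V 0 with rfl | hV
    · simp [Real.zero_rpow (by linarith : p ≠ 0)]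
    · rw [mul_assoc, ← abs_mul_abs_self V, ← sq, ← Real.rpow_natCast,
        ← Real.rpow_add (by positivity)]
      norm_num
  have hU : |u| ^ p = (A ^ p)⁻¹ * r ^ p * φ ^ p * |E| ^ p := by
    rw [hu, abs_mul, abs_neg, abs_of_pos (by positivity), Real.mul_rpow (by positivity)
      (by positivity), Real.mul_rpow (by positivity) hφ.le, Real.mul_rpow (by positivity) hr.le,
      Real.inv_rpow hA.le]
  have h1 : r ^ (-α) = (r ^ α)⁻¹ := Real.rpow_neg hr.le _
  have h2 : φ ^ (-β) = (φ ^ β)⁻¹ := Real.rpow_neg hφ.le _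
  have h3 : φ ^ (1 - β) = φ / φ ^ β := by rw [Real.rpow_sub hφ, Real.rpow_one]
  have h4 : φ ^ (β - 1) = φ ^ β / φ := by rw [Real.rpow_sub hφ, Real.rpow_one]
  rw [h4, Real.rpow_sub hr, Real.rpow_sub hφ β p, h1, h2, h3]
  have hrα : 0 < r ^ α := by positivity
  have hφβ : 0 < φ ^ β := by positivity
  have hrp : 0 < r ^ p := by positivity
  have hφp : 0 < φ ^ p := by positivity
  have hAp : 0 < A ^ p := by positivity
  have hI : p * (Ip p V u * |V - u| ^ 2) = (A ^ p)⁻¹ * r ^ p * φ ^ p * |E| ^ p - |V| ^ p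
      + p * |V| ^ p + p * |V| ^ (p - 2) * V * (A⁻¹ * r * φ * E) := by
    rw [← hU, hT, ← hVV, hu]; ring
  have : p * A ^ p * (Ip p V u * |V - u| ^ 2 / (r ^ α * φ ^ β))
      = A ^ p * (p * (Ip p V u * |V - u| ^ 2)) / (r ^ α * φ ^ β) := by ring
  rw [this, hI, ← hAc]
  generalize |V| ^ p = P at *
  generalize |V| ^ (p - 2) = Q at *
  generalize |E| ^ p = D at *
  field_simp
  ring

/-- The first-order `L^p` Hardy identity with remainder terms on the ball. -/
lemma hardy_identity {n : ℕ} {R : ℝ} {p α β A c : ℝ} (hp : 1 < p) (hA : 0 < A)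
    (hc : 0 < c) (hAc : p * A = (β - 1) * c) {v : EuclideanSpace ℝ (Fin n) → ℝ}
    (hv : ContDiff ℝ 1 v) (hcomp : HasCompactSupport v)
    (hsupp : tsupport v ⊆ ball (0 : EuclideanSpace ℝ (Fin n)) R \ {0})
    {u : EuclideanSpace ℝ (Fin n) → ℝ}
    (hu : ∀ x, u x = A⁻¹ * ‖x‖ * (1 - (‖x‖ / R) ^ c) * -radDerivR v x) :
    A ^ p * (∫ x in ball (0 : EuclideanSpace ℝ (Fin n)) R,
        |v x| ^ p / (‖x‖ ^ α * (1 - (‖x‖ / R) ^ c) ^ β))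
      + p * A ^ p * (∫ x in ball (0 : EuclideanSpace ℝ (Fin n)) R,
        Ip p (v x) (u x) * |v x - u x| ^ 2 / (‖x‖ ^ α * (1 - (‖x‖ / R) ^ c) ^ β))
      + (n - α - (β - 1) * c) * A⁻¹ * A ^ p * (∫ x in ball (0 : EuclideanSpace ℝ (Fin n)) R,
        |v x| ^ p / (‖x‖ ^ α * (1 - (‖x‖ / R) ^ c) ^ (β - 1)))
    = ∫ x in ball (0 : EuclideanSpace ℝ (Fin n)) R,
        |radDerivR v x| ^ p / (‖x‖ ^ (α - p) * (1 - (‖x‖ / R) ^ c) ^ (β - p)) := by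
  have hp0 : p ≠ 0 := by linarith
  have hrad : ContDiff ℝ 0 (radDerivR v) := by
    exact_mod_cast ContDiff.radDerivR (m := 0) (by simpa using hv) fun h => (hsupp h).2 rfl
  -- integrability of `|w|^p` against the weights
  have hint (w : EuclideanSpace ℝ (Fin n) → ℝ) (hw : Continuous w)
      (hw0 : ∀ x ∉ tsupport v, w x = 0) (s t : ℝ) : Integrable fun x =>
        |w x| ^ p / (‖x‖ ^ s * (1 - (‖x‖ / R) ^ c) ^ t) := by
    refine integrable_of_continuousOn_of_eq_zero (K := tsupport v) hcomp ?_ fun x hx => ?_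
    · refine ContinuousOn.div (hw.abs.rpow_const fun _ => Or.inr (by linarith)).continuousOn
        (fun x hx => (contDiffAt_hardyWeight hc (hsupp hx) s t).continuousAt.continuousWithinAt)
        fun x hx => ?_
      have hr : 0 < ‖x‖ := norm_pos_iff.2 (hsupp hx).2
      have := one_sub_div_rpow_pos hc hr (mem_ball_zero_iff.1 (hsupp hx).1)
      positivity
    · simp [hw0 x hx, Real.zero_rpow hp0]
  have hv0 : ∀ x ∉ tsupport v, v x = 0 := fun x hx => image_eq_zero_of_notMem_tsupport hx
  have hI1 := hint v hv.continuous hv0 α β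
  have hI3 := hint v hv.continuous hv0 α (β - 1)
  have hI4 := hint _ hrad.continuous (fun x hx => radDerivR_of_notMem_tsupport hx) (α - p) (β - p)
  set G : EuclideanSpace ℝ (Fin n) → ℝ := fun x =>
    |v x| ^ p * (‖x‖ ^ (-α) * (1 - (‖x‖ / R) ^ c) ^ (1 - β)) with hG
  have hGsupp : tsupport G ⊆ tsupport v := by
    refine closure_minimal (fun x hx => ?_) isClosed_closure
    by_contra h
    exact hx (by simp [hG, hv0 x h, Real.zero_rpow hp0])
  have hGcomp : HasCompactSupport G := hcomp.mono' (subset_closure.trans hGsupp)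
  have hGdiff : ContDiff ℝ 1 G := contDiff_of_contDiffAt_tsupport fun x hx =>
    (by simpa using (hv.norm_rpow hp).contDiffAt : ContDiffAt ℝ 1 (fun x => |v x| ^ p) x).mul
      (contDiffAt_hardyWeight hc (hsupp (hGsupp hx)) _ _)
  have hdivint : Integrable fun x => (n : ℝ) * G x + fderiv ℝ G x x := by
    have := hGdiff.continuous_fderiv one_ne_zero
    have := hGdiff.continuous
    refine integrable_of_continuousOn_of_eq_zero (K := tsupport G) hGcomp
      (by fun_prop) fun x hx => ?_
    simp [fderiv_of_notMem_tsupport (𝕜 := ℝ) hx, image_eq_zero_of_notMem_tsupport hx]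
  have hdiv : ∫ x in ball (0 : EuclideanSpace ℝ (Fin n)) R, ((n : ℝ) * G x + fderiv ℝ G x x)
      = 0 := by
    rw [setIntegral_eq_integral_of_forall_compl_eq_zero, integral_add, integral_const_mul,
      integral_fderiv_apply_self hGdiff hGcomp, add_neg_cancel]
    · exact (hGdiff.continuous.integrable_of_hasCompactSupport hGcomp).const_mul _
    · have := hGdiff.continuous_fderiv one_ne_zero
      refine integrable_of_continuousOn_of_eq_zero (K := tsupport G) hGcomp
        (by fun_prop) fun x hx => ?_
      simp [fderiv_of_notMem_tsupport (𝕜 := ℝ) hx]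
    · intro x hx
      have hx' : x ∉ tsupport G := fun h => hx (hsupp (hGsupp h)).1
      simp [fderiv_of_notMem_tsupport (𝕜 := ℝ) hx', image_eq_zero_of_notMem_tsupport hx']
  have hpt (x : EuclideanSpace ℝ (Fin n)) :
      A ^ p * (|v x| ^ p / (‖x‖ ^ α * (1 - (‖x‖ / R) ^ c) ^ β))
      + p * A ^ p * (Ip p (v x) (u x) * |v x - u x| ^ 2 / (‖x‖ ^ α * (1 - (‖x‖ / R) ^ c) ^ β))
      + (n - α - (β - 1) * c) * A⁻¹ * A ^ p *
        (|v x| ^ p / (‖x‖ ^ α * (1 - (‖x‖ / R) ^ c) ^ (β - 1)))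
      - |radDerivR v x| ^ p / (‖x‖ ^ (α - p) * (1 - (‖x‖ / R) ^ c) ^ (β - p))
      = A ^ p * A⁻¹ * (n * G x + fderiv ℝ G x x) := by
    by_cases hx : x ∈ tsupport v
    · have hr : 0 < ‖x‖ := norm_pos_iff.2 (hsupp hx).2
      have hrR : ‖x‖ < R := mem_ball_zero_iff.1 (hsupp hx).1
      have hφ := one_sub_div_rpow_pos hc hr hrR
      rw [hardy_pointwise (N := n) hp hA hr hφ hAc (hu x)]
      congr 2
      have hray : HasDerivAt (fun t : ℝ => t • x) x 1 := by
        simpa using (hasDerivAt_id (1 : ℝ)).smul_const x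
      have hd1 : HasDerivAt (fun t : ℝ => G (t • x)) (fderiv ℝ G x x) 1 := by
        have : HasFDerivAt G (fderiv ℝ G x) ((1 : ℝ) • x) := by
          rw [one_smul]; exact (hGdiff.differentiable one_ne_zero x).hasFDerivAt
        exact this.comp_hasDerivAt 1 hray
      have hd2 : HasDerivAt (fun t : ℝ => v (t • x)) (‖x‖ * radDerivR v x) 1 := by
        have : HasFDerivAt v (fderiv ℝ v x) ((1 : ℝ) • x) := by
          rw [one_smul]; exact (hv.differentiable one_ne_zero x).hasFDerivAt
        refine (this.comp_hasDerivAt 1 hray).congr_deriv ?_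
        rw [radDerivR, map_smul, smul_eq_mul, mul_inv_cancel_left₀ hr.ne']
      have hd3 := ((hasDerivAt_abs_rpow (v ((1 : ℝ) • x)) hp).comp 1 hd2).mul
        (hasDerivAt_hardyWeight hc hr hrR α β)
      have heq : (fun t : ℝ => G (t • x)) =ᶠ[nhds 1] (fun t : ℝ => |v (t • x)| ^ p *
          ((t * ‖x‖) ^ (-α) * (1 - (t * ‖x‖ / R) ^ c) ^ (1 - β))) := by
        filter_upwards [lt_mem_nhds (zero_lt_one (α := ℝ))] with t ht
        simp only [hG, norm_smul, Real.norm_eq_abs, abs_of_pos ht]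
      rw [hd1.unique (hd3.congr_of_eventuallyEq heq)]
      simp only [Function.comp, one_smul, one_mul]
      ring
    · have h1 : x ∉ tsupport G := fun h => hx (hGsupp h)
      have h2 := radDerivR_of_notMem_tsupport hx
      simp [fderiv_of_notMem_tsupport (𝕜 := ℝ) h1, image_eq_zero_of_notMem_tsupport h1, hu x, h2,
        hv0 x hx, Real.zero_rpow hp0]
  have hI2 : (fun x => Ip p (v x) (u x) * |v x - u x| ^ 2 /
      (‖x‖ ^ α * (1 - (‖x‖ / R) ^ c) ^ β)) = fun x => (p * A ^ p)⁻¹ *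
      (A ^ p * A⁻¹ * (n * G x + fderiv ℝ G x x)
      + |radDerivR v x| ^ p / (‖x‖ ^ (α - p) * (1 - (‖x‖ / R) ^ c) ^ (β - p))
      - A ^ p * (|v x| ^ p / (‖x‖ ^ α * (1 - (‖x‖ / R) ^ c) ^ β))
      - (n - α - (β - 1) * c) * A⁻¹ * A ^ p *
        (|v x| ^ p / (‖x‖ ^ α * (1 - (‖x‖ / R) ^ c) ^ (β - 1)))) := by
    funext x
    have : p * A ^ p ≠ 0 := by positivity
    rw [eq_inv_mul_iff_mul_eq₀ this, ← hpt x]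
    ring
  have hpA : p * A ^ p ≠ 0 := by positivity
  rw [hI2, integral_const_mul, integral_sub, integral_sub, integral_add, integral_const_mul,
    integral_const_mul, integral_const_mul, hdiv, mul_inv_cancel_left₀ hpA]
  · ring
  · exact (hdivint.const_mul _).integrableOn
  · exact hI4.integrableOn
  · exact ((hdivint.const_mul _).add hI4).integrableOn
  · exact (hI1.const_mul _).integrableOn
  · exact (((hdivint.const_mul _).add hI4).sub (hI1.const_mul _)).integrableOn
  · exact (hI3.const_mul _).integrableOn

theorem unified_higher_order_Lp_identity {n : ℕ} (hn : 1 ≤ n) {R : ℝ} (hR : 0 < R)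
    {k : ℕ} (hk : 1 ≤ k) {p b a c : ℝ} (hp : 1 < p) (hb : 1 < b)
    (ha : a + ((k : ℝ) - 1) * p < (n : ℝ))
    (hc0 : 0 < c) (hc : c ≤ ((n : ℝ) - a - ((k : ℝ) - 1) * p) / (b + ((k : ℝ) - 1) * p - 1))
    (f : EuclideanSpace ℝ (Fin n) → ℝ)
    (hf : ContDiff ℝ k f) (hcomp : HasCompactSupport f)
    (hsupp : tsupport f ⊆ ball (0 : EuclideanSpace ℝ (Fin n)) R \ {0})
    (u : ℕ → EuclideanSpace ℝ (Fin n) → ℝ)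
    (hu : ∀ i ∈ Finset.range k, ∀ x, u i x =
      p / ((b + (i : ℝ) * p - 1) * c) * ‖x‖ * (1 - (‖x‖ / R) ^ c) *
        (-(radDerivR^[k - i] f x))) :
    (∏ j ∈ Finset.range k, ((b + (j : ℝ) * p - 1) * c / p) ^ p) *
      (∫ x in ball (0 : EuclideanSpace ℝ (Fin n)) R,
        |f x| ^ p / (‖x‖ ^ (a + ((k : ℝ) - 1) * p) *
          (1 - (‖x‖ / R) ^ c) ^ (b + ((k : ℝ) - 1) * p))) +
    p * (∑ i ∈ Finset.range k,
      (∏ j ∈ Finset.range (i + 1), ((b + (j : ℝ) * p - 1) * c / p) ^ p) *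
        ∫ x in ball (0 : EuclideanSpace ℝ (Fin n)) R,
          Ip p ((radDerivR^[k - 1 - i] f) x) (u i x) *
            |(radDerivR^[k - 1 - i] f) x - u i x| ^ 2 /
            (‖x‖ ^ (a + (i : ℝ) * p) * (1 - (‖x‖ / R) ^ c) ^ (b + (i : ℝ) * p))) +
    (∑ i ∈ Finset.range k,
      ((n : ℝ) - a - (i : ℝ) * p - (b + (i : ℝ) * p - 1) * c) *
        ((b + (i : ℝ) * p - 1) * c / p)⁻¹ *
        (∏ j ∈ Finset.range (i + 1), ((b + (j : ℝ) * p - 1) * c / p) ^ p) *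
        ∫ x in ball (0 : EuclideanSpace ℝ (Fin n)) R,
          |(radDerivR^[k - 1 - i] f) x| ^ p /
            (‖x‖ ^ (a + (i : ℝ) * p) * (1 - (‖x‖ / R) ^ c) ^ (b + (i : ℝ) * p - 1))) =
    ∫ x in ball (0 : EuclideanSpace ℝ (Fin n)) R,
        |(radDerivR^[k] f) x| ^ p / (‖x‖ ^ (a - p) * (1 - (‖x‖ / R) ^ c) ^ (b - p)) := by
  have h0 : (0 : EuclideanSpace ℝ (Fin n)) ∉ tsupport f := fun h => (hsupp h).2 rfl
  set A : ℕ → ℝ := fun j => (b + (j : ℝ) * p - 1) * c / p with hA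
  have hApos (j : ℕ) : 0 < A j := by
    have h1 : 0 ≤ (j : ℝ) * p := by positivity
    have h2 : 0 < b + (j : ℝ) * p - 1 := by linarith
    simp only [hA]
    positivity
  set J : ℕ → ℝ := fun i => (∏ j ∈ Finset.range i, A j ^ p) *
    ∫ x in ball (0 : EuclideanSpace ℝ (Fin n)) R, |(radDerivR^[k - i] f) x| ^ p /
      (‖x‖ ^ (a + ((i : ℝ) - 1) * p) * (1 - (‖x‖ / R) ^ c) ^ (b + ((i : ℝ) - 1) * p)) with hJ
  have hstep : ∀ i ∈ Finset.range k, p * ((∏ j ∈ Finset.range (i + 1), A j ^ p) *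
        ∫ x in ball (0 : EuclideanSpace ℝ (Fin n)) R,
          Ip p ((radDerivR^[k - 1 - i] f) x) (u i x) *
            |(radDerivR^[k - 1 - i] f) x - u i x| ^ 2 /
            (‖x‖ ^ (a + (i : ℝ) * p) * (1 - (‖x‖ / R) ^ c) ^ (b + (i : ℝ) * p))) +
      ((n : ℝ) - a - (i : ℝ) * p - (b + (i : ℝ) * p - 1) * c) * (A i)⁻¹ *
        (∏ j ∈ Finset.range (i + 1), A j ^ p) *
        ∫ x in ball (0 : EuclideanSpace ℝ (Fin n)) R,
          |(radDerivR^[k - 1 - i] f) x| ^ p /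
            (‖x‖ ^ (a + (i : ℝ) * p) * (1 - (‖x‖ / R) ^ c) ^ (b + (i : ℝ) * p - 1))
      = J i - J (i + 1) := by
    intro i hi
    have hik : i < k := Finset.mem_range.1 hi
    have hm : k - i = (k - 1 - i) + 1 := by omega
    obtain ⟨hv, hvs⟩ := radDerivR_iterate_regularity h0 (k - 1 - i) 1
      (hf.of_le (by norm_cast; omega))
    have hrad : radDerivR^[k - i] f = radDerivR (radDerivR^[k - 1 - i] f) := by
      rw [hm, Function.iterate_succ_apply']
    have hid := hardy_identity (α := a + (i : ℝ) * p) (β := b + (i : ℝ) * p) (R := R) hp (hApos i)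
      hc0 (by simp only [hA]; field_simp) (by exact_mod_cast hv)
      (hcomp.mono' (subset_closure.trans hvs)) (hvs.trans hsupp) (u := u i) (fun x => by
        rw [hu i hi x, hrad]; simp only [hA, inv_div])
    simp only [hJ, hrad, Finset.prod_range_succ, Nat.cast_add, Nat.cast_one, add_sub_cancel_right,
      show k - (i + 1) = k - 1 - i by omega]
    rw [show a + ((i : ℝ) - 1) * p = a + (i : ℝ) * p - p by ring,
      show b + ((i : ℝ) - 1) * p = b + (i : ℝ) * p - p by ring, ← hid]
    ring
  have hsum := Finset.sum_congr rfl hstep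
  rw [Finset.sum_range_sub', Finset.sum_add_distrib, ← Finset.mul_sum] at hsum
  rw [add_assoc, hsum]
  simp [hJ, hA, ← sub_eq_add_neg]
end

section
/- Let n ≥ 1, R > 0, k ≥ 1 an integer, 1 < p < ∞, b > 1, a + (k-1)p < n and 0 < c ≤ (n-a-(k-1)p)/(b+(k-1)p-1). Then for every complex-valued function f ∈ C_0^k(B(0,R)\{0}) one has ∏_{j=0}^{k-1} ((b+jp-1)c/p)^p · ∫_{B(0,R)} |f(x)|^p / (|x|^{a+(k-1)p} (1-(|x|/R)^c)^{b+(k-1)p}) dx ≤ ∫_{B(0,R)} |𝓡^k f(x)|^p / (|x|^{a-p} (1-(|x|/R)^c)^{b-p}) dx. -/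
open MeasureTheory Metric

/-- The radial derivative `𝓡f(x) = Df(x)[x/|x|]` of a complex-valued function on `ℝⁿ`. -/
noncomputable def radDeriv {n : ℕ} (f : EuclideanSpace ℝ (Fin n) → ℂ)
    (x : EuclideanSpace ℝ (Fin n)) : ℂ :=
  fderiv ℝ f x (‖x‖⁻¹ • x)

/-- The integral of `div (g x)` over `ℝⁿ` vanishes. -/
lemma integral_fderiv_self_add_eq_zero {n : ℕ} {g : EuclideanSpace ℝ (Fin n) → ℝ}
    (hg : ContDiff ℝ 1 g) (hgc : HasCompactSupport g) :
    ∫ x, (fderiv ℝ g x x + n * g x) = 0 := by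
  have hcoord : ∀ i : Fin n, ContDiff ℝ 1 (fun x : EuclideanSpace ℝ (Fin n) ↦ x i) :=
    fun i ↦ (EuclideanSpace.proj i : EuclideanSpace ℝ (Fin n) →L[ℝ] ℝ).contDiff
  have hcoord' : ∀ (i : Fin n) (x v : EuclideanSpace ℝ (Fin n)),
      fderiv ℝ (fun x : EuclideanSpace ℝ (Fin n) ↦ x i) x v = v i := fun i x v ↦ by
    have := (EuclideanSpace.proj i : EuclideanSpace ℝ (Fin n) →L[ℝ] ℝ).hasFDerivAt (x := x)
    exact congrArg (fun L ↦ L v) this.fderiv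
  have hgi : Integrable g := hg.continuous.integrable_of_hasCompactSupport hgc
  have hd : ∀ v : EuclideanSpace ℝ (Fin n), Continuous fun x ↦ fderiv ℝ g x v := fun v ↦
    (hg.continuous_fderiv one_ne_zero).clm_apply continuous_const
  have hint : ∀ i : Fin n, Integrable (fun x : EuclideanSpace ℝ (Fin n) ↦
      x i * fderiv ℝ g x (EuclideanSpace.single i 1)) := fun i ↦
    ((hcoord i).continuous.mul (hd _)).integrable_of_hasCompactSupport
      ((hgc.fderiv_apply ℝ _).mul_left)
  have hparts : ∀ i : Fin n, ∫ x : EuclideanSpace ℝ (Fin n),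
      x i * fderiv ℝ g x (EuclideanSpace.single i 1) = - ∫ x, g x := fun i ↦ by
    rw [integral_mul_fderiv_eq_neg_fderiv_mul_of_integrable]
    · simp [hcoord']
    · simpa [hcoord'] using hgi
    · exact hint i
    · exact ((hcoord i).continuous.mul hg.continuous).integrable_of_hasCompactSupport hgc.mul_left
    · exact fun x _ ↦ (hcoord i).differentiable one_ne_zero x
    · exact fun x _ ↦ hg.differentiable one_ne_zero x
  have hsum : ∀ x, fderiv ℝ g x x =
      ∑ i, x i * fderiv ℝ g x (EuclideanSpace.single i 1) := fun x ↦ by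
    have h := congrArg (fderiv ℝ g x) ((EuclideanSpace.basisFun (Fin n) ℝ).sum_repr x)
    rw [map_sum] at h
    simpa using h.symm
  simp_rw [hsum]
  rw [integral_add (integrable_finsetSum _ fun i _ ↦ hint i) (hgi.const_mul _),
    integral_finsetSum _ fun i _ ↦ hint i, integral_const_mul]
  simp [hparts]

lemma rpow_div_mem_Ioo {R c r : ℝ} (hR : 0 < R) (hc0 : 0 < c) (hr : 0 < r) (hrR : r < R) :
    0 < (r / R) ^ c ∧ (r / R) ^ c < 1 :=
  ⟨by positivity, Real.rpow_lt_one (by positivity) ((div_lt_one hR).2 hrR) hc0⟩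

lemma contDiffAt_radial_weight {E : Type*} [NormedAddCommGroup E] [InnerProductSpace ℝ E]
    {R c : ℝ} (hR : 0 < R) (hc0 : 0 < c) (α β : ℝ) {x : E} (hx : x ∈ ball (0 : E) R \ {0}) :
    ContDiffAt ℝ 1 (fun x : E ↦ ‖x‖ ^ α * (1 - (‖x‖ / R) ^ c) ^ β) x := by
  have hx0 : x ≠ 0 := hx.2
  have hr : 0 < ‖x‖ := norm_pos_iff.2 hx0
  have hρ := rpow_div_mem_Ioo hR hc0 hr (by simpa using hx.1)
  have hn : ContDiffAt ℝ 1 (fun x : E ↦ ‖x‖) x := contDiffAt_norm ℝ hx0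
  exact (hn.rpow_const_of_ne hr.ne').mul
    ((contDiffAt_const.sub ((hn.div_const R).rpow_const_of_ne (by positivity))).rpow_const_of_ne
      (sub_pos.2 hρ.2).ne')

lemma tsupport_norm_rpow_mul_subset {E F : Type*} [TopologicalSpace E] [NormedAddCommGroup F]
    {p : ℝ} (hp : p ≠ 0) (f : E → F) (w : E → ℝ) :
    tsupport (fun x ↦ ‖f x‖ ^ p * w x) ⊆ tsupport f :=
  closure_mono fun x hx ↦ by
    contrapose! hx
    simp [Function.notMem_support.1 hx, Real.zero_rpow hp]

lemma integrable_norm_rpow_div_weight {n : ℕ} {R c p : ℝ} (hR : 0 < R) (hc0 : 0 < c) (hp : 0 < p)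
    (α β : ℝ) {f : EuclideanSpace ℝ (Fin n) → ℂ} (hf : Continuous f) (hcomp : HasCompactSupport f)
    (hsupp : tsupport f ⊆ ball (0 : EuclideanSpace ℝ (Fin n)) R \ {0}) :
    Integrable fun x ↦ ‖f x‖ ^ p / (‖x‖ ^ α * (1 - (‖x‖ / R) ^ c) ^ β) := by
  simp_rw [div_eq_mul_inv]
  have hts := tsupport_norm_rpow_mul_subset hp.ne' f
    (fun x ↦ (‖x‖ ^ α * (1 - (‖x‖ / R) ^ c) ^ β)⁻¹)
  refine Continuous.integrable_of_hasCompactSupport (continuous_of_tsupport fun x hx ↦ ?_)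
    (hcomp.of_isClosed_subset isClosed_closure hts)
  have hx' := hsupp (hts hx)
  have hr : 0 < ‖x‖ := norm_pos_iff.2 hx'.2
  have hρ := rpow_div_mem_Ioo hR hc0 hr (by simpa using hx'.1)
  have h1 := sub_pos.2 hρ.2
  exact (hf.continuousAt.norm.rpow_const (Or.inr hp.le)).mul
    ((contDiffAt_radial_weight hR hc0 α β hx').continuousAt.inv₀ (by positivity))

lemma tsupport_radDeriv_subset {n : ℕ} (f : EuclideanSpace ℝ (Fin n) → ℂ) :
    tsupport (radDeriv f) ⊆ tsupport f :=
  (closure_mono fun x hx ↦ by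
    contrapose! hx
    simp [radDeriv, Function.notMem_support.1 hx]).trans (tsupport_fderiv_subset ℝ)

lemma contDiff_radDeriv {n k : ℕ} {f : EuclideanSpace ℝ (Fin n) → ℂ}
    (hf : ContDiff ℝ (k + 1 : ℕ) f) (h0 : (0 : EuclideanSpace ℝ (Fin n)) ∉ tsupport f) :
    ContDiff ℝ k (radDeriv f) := by
  rw [contDiff_iff_contDiffAt]
  intro x
  by_cases hx : x = 0
  · have h0' : x ∉ tsupport (radDeriv f) := fun h ↦ h0 (hx ▸ tsupport_radDeriv_subset f h)
    exact contDiffAt_const.congr_of_eventuallyEq (notMem_tsupport_iff_eventuallyEq.1 h0')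
  · exact ((hf.fderiv_right (m := k) (by push_cast; rfl)).contDiffAt).clm_apply
      (((contDiffAt_norm ℝ hx).inv (norm_ne_zero_iff.2 hx)).smul contDiffAt_id)

/-- Radial derivative of the vector-field weight `r ^ (-a) * (1 - (r / R) ^ c) ^ (1 - b)`. -/
lemma exists_hasDerivAt_weight {R a b c N r : ℝ} (hR : 0 < R) (hc0 : 0 < c) (hr : 0 < r)
    (hrR : r < R) (hcN : c * (b - 1) ≤ N - a) :
    ∃ q' : ℝ, HasDerivAt (fun r : ℝ ↦ r ^ (-a) * (1 - (r / R) ^ c) ^ (1 - b)) q' r ∧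
      (b - 1) * c * (r ^ a * (1 - (r / R) ^ c) ^ b)⁻¹ ≤
        q' * r + N * (r ^ (-a) * (1 - (r / R) ^ c) ^ (1 - b)) := by
  have hρ := rpow_div_mem_Ioo hR hc0 hr hrR
  have h1 := sub_pos.2 hρ.2
  have hd := (Real.hasDerivAt_rpow_const (p := -a) (Or.inl hr.ne')).mul
    ((((hasDerivAt_id r).div_const R).rpow_const (p := c)
      (Or.inl (by simp only [id]; positivity))).const_sub 1 |>.rpow_const (p := 1 - b)
      (Or.inl h1.ne'))
  refine ⟨_, hd, ?_⟩
  have e1 : r ^ (-a - 1) = r ^ (-a) / r := Real.rpow_sub_one hr.ne' _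
  have e2 : (r / R) ^ (c - 1) = (r / R) ^ c / (r / R) := Real.rpow_sub_one (by positivity) _
  have e3 : (1 - (r / R) ^ c) ^ (1 - b) = (1 - (r / R) ^ c) * (1 - (r / R) ^ c) ^ (-b) := by
    rw [sub_eq_add_neg 1 b, Real.rpow_add h1, Real.rpow_one]
  have e4 : (1 - (r / R) ^ c) ^ (1 - b - 1) = (1 - (r / R) ^ c) ^ (-b) := by ring_nf
  simp only [id, e1, e2, e3, e4]
  rw [mul_inv, ← Real.rpow_neg hr.le, ← Real.rpow_neg h1.le]
  have hA : 0 < r ^ (-a) := by positivity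
  have hB : 0 < (1 - (r / R) ^ c) ^ (-b) := by positivity
  generalize (1 - (r / R) ^ c) ^ (-b) = B at *
  generalize (r / R) ^ c = ρ at *
  generalize r ^ (-a) = A at *
  have key : 0 ≤ A * B * ((N - a - c * (b - 1)) * (1 - ρ)) :=
    mul_nonneg (by positivity) (mul_nonneg (by linarith) h1.le)
  rw [← sub_nonneg]
  convert key using 1
  field_simp
  ring

/-- Young's inequality in the form used to absorb the gradient term. -/
lemma young_absorb {p X Y l : ℝ} (hp : 1 < p) (hX : 0 ≤ X) (hY : 0 ≤ Y) (hl : 0 ≤ l) :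
    l ^ (p - 1) * (p * (X ^ (p - 1) * Y)) ≤ (p - 1) * (l ^ p * X ^ p) + Y ^ p := by
  have hpq := (Real.HolderConjugate.conjExponent hp)
  have h := Real.young_inequality_of_nonneg (Real.rpow_nonneg (mul_nonneg hl hX) (p - 1)) hY
    hpq.symm
  rw [← Real.rpow_mul (mul_nonneg hl hX), hpq.sub_one_mul_conj, Real.conjExponent,
    Real.mul_rpow hl hX, Real.mul_rpow hl hX] at h
  have hp0 : 0 < p := by linarith
  have := mul_le_mul_of_nonneg_left h hp0.le
  have h1 : p - 1 ≠ 0 := by linarith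
  calc _ = p * (l ^ (p - 1) * X ^ (p - 1) * Y) := by ring
    _ ≤ _ := this
    _ = _ := by field_simp

lemma radial_norm_rpow_div_weight {p a b r ρ D : ℝ} (hr : 0 < r) (hρ : 0 < 1 - ρ) (hD : 0 ≤ D) :
    (D * r * (1 - ρ)) ^ p * (r ^ a * (1 - ρ) ^ b)⁻¹ =
      D ^ p / (r ^ (a - p) * (1 - ρ) ^ (b - p)) := by
  rw [Real.mul_rpow (by positivity) hρ.le, Real.mul_rpow hD hr.le, Real.rpow_sub hr,
    Real.rpow_sub hρ]
  field_simp

/-- The first order radial `L^p` Hardy inequality. -/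
lemma radial_Lp_hardy_inequality {n : ℕ} {R p b a c : ℝ} (hR : 0 < R) (hp : 1 < p) (hb : 1 < b)
    (hc0 : 0 < c) (hc : c ≤ ((n : ℝ) - a) / (b - 1))
    {f : EuclideanSpace ℝ (Fin n) → ℂ} (hf : ContDiff ℝ 1 f) (hcomp : HasCompactSupport f)
    (hsupp : tsupport f ⊆ ball (0 : EuclideanSpace ℝ (Fin n)) R \ {0}) :
    ((b - 1) * c / p) ^ p * (∫ x in ball (0 : EuclideanSpace ℝ (Fin n)) R,
        ‖f x‖ ^ p / (‖x‖ ^ a * (1 - (‖x‖ / R) ^ c) ^ b)) ≤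
    ∫ x in ball (0 : EuclideanSpace ℝ (Fin n)) R,
        ‖radDeriv f x‖ ^ p / (‖x‖ ^ (a - p) * (1 - (‖x‖ / R) ^ c) ^ (b - p)) := by
  have hp0 : 0 < p := by linarith
  have hcN : c * (b - 1) ≤ n - a := (le_div_iff₀ (by linarith)).1 hc
  have hD : ContDiff ℝ 0 (radDeriv f) := contDiff_radDeriv (k := 0) (by simpa using hf)
    fun h ↦ (hsupp h).2 rfl
  have hDs := tsupport_radDeriv_subset f
  have hI1 := integrable_norm_rpow_div_weight hR hc0 hp0 a b hf.continuous hcomp hsupp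
  have hI2 := integrable_norm_rpow_div_weight hR hc0 hp0 (a - p) (b - p) hD.continuous
    (hcomp.of_isClosed_subset isClosed_closure hDs) (hDs.trans hsupp)
  set q : ℝ → ℝ := fun r ↦ r ^ (-a) * (1 - (r / R) ^ c) ^ (1 - b) with hq
  set g : EuclideanSpace ℝ (Fin n) → ℝ := fun x ↦ ‖f x‖ ^ p * q ‖x‖ with hg
  have hgs : tsupport g ⊆ tsupport f := tsupport_norm_rpow_mul_subset hp0.ne' f _
  have hgc : HasCompactSupport g := hcomp.of_isClosed_subset isClosed_closure hgs
  have hg1 : ContDiff ℝ 1 g := contDiff_iff_contDiffAt.2 fun x ↦ by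
    by_cases hx : x ∈ tsupport g
    · exact (hf.norm_rpow hp).contDiffAt.mul
        (contDiffAt_radial_weight hR hc0 _ _ (hsupp (hgs hx)))
    · exact contDiffAt_const.congr_of_eventuallyEq (notMem_tsupport_iff_eventuallyEq.1 hx)
  have hgI : Integrable fun x ↦ fderiv ℝ g x x + n * g x := by
    refine Continuous.integrable_of_hasCompactSupport
      (((hg1.continuous_fderiv one_ne_zero).clm_apply continuous_id).add
        (continuous_const.mul hg1.continuous)) (hgc.mono' fun x hx ↦ ?_)
    contrapose! hx
    simp [fderiv_of_notMem_tsupport ℝ hx, image_eq_zero_of_notMem_tsupport hx]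
  set l : ℝ := (b - 1) * c / p with hl
  have hl0 : 0 < l := div_pos (mul_pos (by linarith) hc0) hp0
  have key : ∀ x ∈ ball (0 : EuclideanSpace ℝ (Fin n)) R,
      l ^ p * (‖f x‖ ^ p / (‖x‖ ^ a * (1 - (‖x‖ / R) ^ c) ^ b)) ≤
        ‖radDeriv f x‖ ^ p / (‖x‖ ^ (a - p) * (1 - (‖x‖ / R) ^ c) ^ (b - p)) +
          l ^ (p - 1) * (fderiv ℝ g x x + n * g x) := by
    intro x hxR
    by_cases hx : x = 0
    · have hxf : x ∉ tsupport f := fun h ↦ (hsupp h).2 hx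
      have hxg : x ∉ tsupport g := fun h ↦ hxf (hgs h)
      have hxD : x ∉ tsupport (radDeriv f) := fun h ↦ hxf (hDs h)
      simp [fderiv_of_notMem_tsupport ℝ hxg, image_eq_zero_of_notMem_tsupport hxg,
        image_eq_zero_of_notMem_tsupport hxf, image_eq_zero_of_notMem_tsupport hxD,
        Real.zero_rpow hp0.ne']
    have hr : 0 < ‖x‖ := norm_pos_iff.2 hx
    have hrR : ‖x‖ < R := by simpa using hxR
    have hρ := rpow_div_mem_Ioo hR hc0 hr hrR
    have h1 := sub_pos.2 hρ.2
    obtain ⟨q', hq', hle⟩ := exists_hasDerivAt_weight hR hc0 hr hrR hcN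
    have hnd : DifferentiableAt ℝ (fun x : EuclideanSpace ℝ (Fin n) ↦ ‖x‖) x :=
      (contDiffAt_norm ℝ hx (n := 1)).differentiableAt one_ne_zero
    have hfp : DifferentiableAt ℝ (fun x ↦ ‖f x‖ ^ p) x :=
      (hf.norm_rpow hp).differentiable one_ne_zero x
    have hgd : fderiv ℝ g x x =
        ‖f x‖ ^ p * (q' * ‖x‖) + q ‖x‖ * fderiv ℝ (fun x ↦ ‖f x‖ ^ p) x x := by
      have h : fderiv ℝ g x = ‖f x‖ ^ p • q' • fderiv ℝ (fun x ↦ ‖x‖) x +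
          q ‖x‖ • fderiv ℝ (fun x ↦ ‖f x‖ ^ p) x :=
        (hfp.hasFDerivAt.mul (hq'.comp_hasFDerivAt x hnd.hasFDerivAt)).fderiv
      rw [h]
      simp [hnd.fderiv_norm_self]
    have hfd : ‖fderiv ℝ f x x‖ = ‖radDeriv f x‖ * ‖x‖ := by
      rw [radDeriv, map_smul, norm_smul, norm_inv, norm_norm]
      field_simp
    have hlow : -(p * (‖f x‖ ^ (p - 1) * (‖radDeriv f x‖ * ‖x‖))) ≤
        fderiv ℝ (fun x ↦ ‖f x‖ ^ p) x x := by
      rw [← hfd]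
      refine neg_le_of_abs_le ?_
      rw [(hf.differentiable one_ne_zero).fderiv_norm_rpow hp]
      simp only [smul_apply, ContinuousLinearMap.comp_apply,
        innerSL_apply_apply, smul_eq_mul, abs_mul, abs_of_pos hp0,
        abs_of_nonneg (Real.rpow_nonneg (norm_nonneg (f x)) (p - 2))]
      calc p * ‖f x‖ ^ (p - 2) * |inner ℝ (f x) (fderiv ℝ f x x)|
          ≤ p * ‖f x‖ ^ (p - 2) * (‖f x‖ * ‖fderiv ℝ f x x‖) := by
            gcongr
            exact abs_real_inner_le_norm _ _
        _ = p * ((‖f x‖ ^ (p - 2) * ‖f x‖) * ‖fderiv ℝ f x x‖) := by ring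
        _ = _ := by
            rw [← Real.rpow_add_one' (norm_nonneg _) (by linarith)]
            ring_nf
    have hqe : q ‖x‖ = (1 - (‖x‖ / R) ^ c) * (‖x‖ ^ a * (1 - (‖x‖ / R) ^ c) ^ b)⁻¹ := by
      simp only [hq]
      rw [sub_eq_add_neg 1 b, Real.rpow_add h1, Real.rpow_one, mul_inv, Real.rpow_neg hr.le,
        Real.rpow_neg h1.le]
      ring
    have hq0 : 0 ≤ q ‖x‖ := by rw [hqe]; positivity
    rw [← radial_norm_rpow_div_weight (b := b) hr h1 (norm_nonneg _), hgd, div_eq_mul_inv]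
    have hw : 0 < (‖x‖ ^ a * (1 - (‖x‖ / R) ^ c) ^ b)⁻¹ := by positivity
    have hyoung := young_absorb hp (norm_nonneg (f x))
      (Y := ‖radDeriv f x‖ * ‖x‖ * (1 - (‖x‖ / R) ^ c)) (by positivity) hl0.le
    have hX : 0 ≤ ‖f x‖ ^ p := by positivity
    have hlp : l ^ p = l ^ (p - 1) * l := by
      rw [← Real.rpow_add_one hl0.ne', sub_add_cancel]
    have hL : 0 < l ^ (p - 1) := by positivity
    have hbc : (b - 1) * c = p * l := by rw [hl]; field_simp
    rw [hbc] at hle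
    have e1 := mul_le_mul_of_nonneg_left hle hX
    have e2 := mul_le_mul_of_nonneg_left hlow hq0
    have e3 := mul_le_mul_of_nonneg_left (add_le_add e1 e2) hL.le
    have e4 := mul_le_mul_of_nonneg_right hyoung hw.le
    rw [hlp] at e4 ⊢
    change _ ≤ _ + l ^ (p - 1) * (_ + n * (‖f x‖ ^ p * q ‖x‖))
    change l ^ (p - 1) * (_ + _) ≤ l ^ (p - 1) * (‖f x‖ ^ p * (q' * ‖x‖ + n * q ‖x‖) + _) at e3
    nth_rewrite 1 [hqe] at e3
    linarith
  have hg0 : ∫ x in ball (0 : EuclideanSpace ℝ (Fin n)) R, (fderiv ℝ g x x + n * g x) = 0 := by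
    rw [setIntegral_eq_integral_of_forall_compl_eq_zero, integral_fderiv_self_add_eq_zero hg1 hgc]
    intro x hx
    have hxg : x ∉ tsupport g := fun h ↦ hx (hsupp (hgs h)).1
    simp [fderiv_of_notMem_tsupport ℝ hxg, image_eq_zero_of_notMem_tsupport hxg]
  have hfin := setIntegral_mono_on (hI1.const_mul (l ^ p)).integrableOn
    (hI2.add (hgI.const_mul (l ^ (p - 1)))).integrableOn measurableSet_ball key
  simp only [Pi.add_apply] at hfin
  rwa [integral_const_mul, integral_add hI2.integrableOn (hgI.const_mul _).integrableOn,
    integral_const_mul, hg0, mul_zero, add_zero] at hfin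

theorem unified_higher_order_Lp_hardy_inequality {n : ℕ} (hn : 1 ≤ n) {R : ℝ} (hR : 0 < R)
    {k : ℕ} (hk : 1 ≤ k) {p b a c : ℝ} (hp : 1 < p) (hb : 1 < b)
    (ha : a + ((k : ℝ) - 1) * p < (n : ℝ))
    (hc0 : 0 < c) (hc : c ≤ ((n : ℝ) - a - ((k : ℝ) - 1) * p) / (b + ((k : ℝ) - 1) * p - 1))
    (f : EuclideanSpace ℝ (Fin n) → ℂ)
    (hf : ContDiff ℝ k f) (hcomp : HasCompactSupport f)
    (hsupp : tsupport f ⊆ ball (0 : EuclideanSpace ℝ (Fin n)) R \ {0}) :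
    (∏ j ∈ Finset.range k, ((b + (j : ℝ) * p - 1) * c / p) ^ p) *
      (∫ x in ball (0 : EuclideanSpace ℝ (Fin n)) R,
        ‖f x‖ ^ p / (‖x‖ ^ (a + ((k : ℝ) - 1) * p) *
          (1 - (‖x‖ / R) ^ c) ^ (b + ((k : ℝ) - 1) * p))) ≤
    ∫ x in ball (0 : EuclideanSpace ℝ (Fin n)) R,
        ‖(radDeriv^[k] f) x‖ ^ p / (‖x‖ ^ (a - p) * (1 - (‖x‖ / R) ^ c) ^ (b - p)) := by
  induction k, hk using Nat.le_induction generalizing f with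
  | base =>
    simpa using radial_Lp_hardy_inequality hR hp hb hc0 (by simpa using hc) (by simpa using hf)
      hcomp hsupp
  | succ k hk ih =>
    have hk1 : (1 : ℝ) ≤ k := by exact_mod_cast hk
    have hkp : 0 ≤ ((k : ℝ) - 1) * p := mul_nonneg (by linarith) (by linarith)
    push_cast at ha hc ⊢
    simp only [add_sub_cancel_right] at ha hc ⊢
    have hDs := tsupport_radDeriv_subset f
    have ih' := ih (by linarith)
      (hc.trans (div_le_div₀ (by linarith) (by linarith) (by linarith) (by linarith)))
      (radDeriv f) (contDiff_radDeriv hf fun h ↦ (hsupp h).2 rfl)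
      (hcomp.of_isClosed_subset isClosed_closure hDs) (hDs.trans hsupp)
    have hstep := radial_Lp_hardy_inequality (a := a + k * p) (b := b + k * p) hR hp
      (by linarith) hc0 (hc.trans_eq (by ring)) (hf.of_le (by exact_mod_cast (by omega)))
      hcomp hsupp
    rw [show a + k * p - p = a + ((k : ℝ) - 1) * p by ring,
      show b + k * p - p = b + ((k : ℝ) - 1) * p by ring] at hstep
    rw [Finset.prod_range_succ, mul_assoc, Function.iterate_succ_apply]
    refine (mul_le_mul_of_nonneg_left hstep (Finset.prod_nonneg fun j _ ↦ ?_)).trans ih'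
    have : 0 ≤ (j : ℝ) * p := mul_nonneg (by positivity) (by linarith)
    exact Real.rpow_nonneg (div_nonneg (mul_nonneg (by linarith) hc0.le) (by linarith)) _
end
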